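/- There is no function Ψ : (ℕ → ℕ → Bool) → (ℕ → Bool) such that (i) for every stable 2-colouring c of pairs of naturals, the set {n | Ψ c n = true} is infinite and homogeneous for c, and (ii) Ψ is continuous at the constant-false colouring. (This is the set-theoretic content of the paper's Corollaries that the uniform versions of Ramsey's theorem for pairs and of stable Ramsey's theorem for pairs are equivalent to arithmetical comprehension: any uniform (stable) Ramsey functional is discontinuous.) -/

import Mathlib

/-- `H` is homogeneous for the 2-colouring `c` of pairs. -/
def Homogeneous (c : ℕ → ℕ → Bool) (H : ℕ → Bool) : Prop :=
  ∃ i : Bool, ∀ k l, k < l → H k = true → H l = true → c k l = i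

/-- The 2-colouring `c` of pairs is stable. -/
def StableColouring (c : ℕ → ℕ → Bool) : Prop :=
  ∀ x, ∃ i : Bool, ∃ N : ℕ, ∀ z, N ≤ z → x < z → c x z = i

open Filter Topology in
theorem tendsto_decide_le_atTop_nhds_false :
    Tendsto (fun N : ℕ => fun _ l : ℕ => decide (N ≤ l)) atTop (𝓝 fun _ _ => false) := by
  refine tendsto_pi_nhds.2 fun _ => tendsto_pi_nhds.2 fun l => ?_
  rw [nhds_discrete, tendsto_pure]
  filter_upwards [eventually_gt_atTop l] with N hN
  simpa using hN

theorem stableColouring_decide_le (N : ℕ) : StableColouring fun _ l => decide (N ≤ l) :=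
  fun _ => ⟨true, N, fun _ hz _ => decide_eq_true hz⟩

/-- There is no uniform (stable) Ramsey functional for pairs that is continuous
at the constant-false colouring. -/
theorem no_continuous_uniform_SRT :
    ¬ ∃ Ψ : (ℕ → ℕ → Bool) → (ℕ → Bool),
      (∀ c : ℕ → ℕ → Bool, StableColouring c →
        {n | Ψ c n = true}.Infinite ∧ Homogeneous c (Ψ c)) ∧
      ContinuousAt Ψ (fun _ _ => false) := by
  rintro ⟨Ψ, hΨ, hcont⟩
  have hinf := (hΨ (fun _ _ => false) fun _ => ⟨false, 0, fun _ _ _ => rfl⟩).1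
  obtain ⟨a, ha, -⟩ := hinf.exists_gt 0
  obtain ⟨b, hb, hab⟩ := hinf.exists_gt a
  have hlim := tendsto_pi_nhds.1 (hcont.tendsto.comp tendsto_decide_le_atTop_nhds_false)
  simp only [nhds_discrete, Filter.tendsto_pure] at hlim
  obtain ⟨N, hNa, hNb, hbN⟩ :=
    ((hlim a).and ((hlim b).and (Filter.eventually_gt_atTop b))).exists
  obtain ⟨hinfN, i, hi⟩ := hΨ _ (stableColouring_decide_le N)
  obtain ⟨l, hl, hNl⟩ := hinfN.exists_gt N
  have hab_col := hi a b hab (hNa.trans ha) (hNb.trans hb)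
  have hal_col := hi a l (by omega) (hNa.trans ha) hl
  rw [← hal_col, decide_eq_decide] at hab_col
  omega
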